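/- (Relative entropy estimate, part (III), temperature reciprocal bound.) Let ê : ℝ¹⁹×[0,∞) → ℝ (with ξ = (F,ζ,w) ∈ M₃(ℝ)×M₃(ℝ)×ℝ) be C³, uniformly convex (∇²_{(ξ,η)}ê ≥ c𝕀 for some c > 0), satisfy the growth conditions (G1)–(G3) with exponents p ≥ 4, q ≥ 2, ρ > 1, ℓ > 1, and assume θ̂(ξ,η) := ∂_η ê(ξ,η) ≥ δ > 0 for all (ξ,η). Then for every M > 0 there is a constant C₅ > 0 such that for all (F,v,η) ∈ M₃(ℝ)×ℝ³×[0,∞) and all (F̄,v̄,η̄) ∈ Γ_M: | ( 1/θ̂(Φ(F),η) − 1/θ̂(Φ(F̄),η̄) ) ( θ̂(Φ(F),η) − θ̂(Φ(F̄),η̄) ) | ≤ C₅ · I(v,Φ(F),η | v̄,Φ(F̄),η̄). -/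

import Mathlib

open scoped BigOperators
noncomputable section

/-- 3×3 real matrices, modelled as `Fin 3 → Fin 3 → ℝ`. -/
abbrev Mat : Type := Fin 3 → Fin 3 → ℝ

/-- The Levi-Civita symbol on `{0,1,2}`. -/
def lc (i j k : Fin 3) : ℝ :=
  (((j : ℕ) : ℝ) - ((i : ℕ) : ℝ)) * (((k : ℕ) : ℝ) - ((i : ℕ) : ℝ)) *
    (((k : ℕ) : ℝ) - ((j : ℕ) : ℝ)) / 2

/-- The cofactor matrix `(cof F)_{iα} = (1/2) Σ ε_{ijk} ε_{αβγ} F_{jβ} F_{kγ}`. -/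
def cof (F : Mat) : Mat := fun i α =>
  (1 / 2) * ∑ j, ∑ k, ∑ β, ∑ γ, lc i j k * lc α β γ * F j β * F k γ

/-- The determinant `det F = (1/6) Σ ε_{ijk} ε_{αβγ} F_{iα} F_{jβ} F_{kγ}`. -/
def mdet (F : Mat) : ℝ :=
  (1 / 6) * ∑ i, ∑ j, ∑ k, ∑ α, ∑ β, ∑ γ, lc i j k * lc α β γ * F i α * F j β * F k γ

/-- Frobenius norm of a 3×3 matrix. -/
def frob (F : Mat) : ℝ := Real.sqrt (∑ i, ∑ j, F i j ^ 2)

/-- The extended state space `ξ = (F, ζ, w) ∈ M₃(ℝ) × M₃(ℝ) × ℝ ≅ ℝ¹⁹`. -/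
abbrev Xi : Type := Mat × Mat × ℝ

/-- Extended state together with the entropy: `(ξ, η) ∈ ℝ¹⁹ × ℝ`. -/
abbrev XE : Type := Xi × ℝ

/-- The natural domain `{η ≥ 0}` of the internal energy. -/
def Dom : Set XE := {x | 0 ≤ x.2}

/-- The null-Lagrangian vector `Φ(F) = (F, cof F, det F)`. -/
def Phi (F : Mat) : Xi := (F, cof F, mdet F)

/-- Directional derivative of `eh` at `x` in the pure-`ξ` direction `d`
(equivalently `Σ_B (∂eh/∂ξ^B)(x) d^B`), taken within the domain `{η ≥ 0}`. -/
def dXi (eh : XE → ℝ) (x : XE) (d : Xi) : ℝ :=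
  fderivWithin ℝ eh Dom x (d, 0)

/-- `θ̂ = ∂eh/∂η`, taken within the domain `{η ≥ 0}`. -/
def dEta (eh : XE → ℝ) (x : XE) : ℝ :=
  fderivWithin ℝ eh Dom x (0, 1)

/-- Matrix of partial derivatives `∂eh/∂F`. -/
def dFmat (eh : XE → ℝ) (x : XE) : Mat :=
  fun i j => dXi eh x (Pi.single i (Pi.single j 1), 0, 0)

/-- Matrix of partial derivatives `∂eh/∂ζ`. -/
def dZmat (eh : XE → ℝ) (x : XE) : Mat :=
  fun i j => dXi eh x (0, Pi.single i (Pi.single j 1), 0)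

/-- Partial derivative `∂eh/∂w`. -/
def dW (eh : XE → ℝ) (x : XE) : ℝ := dXi eh x (0, 0, 1)

/-- Second directional derivative of `eh` at `x`, in directions `u` (outer) and
`d` (inner), within the domain `{η ≥ 0}`. -/
def d2 (eh : XE → ℝ) (x : XE) (u d : XE) : ℝ :=
  fderivWithin ℝ (fun y => fderivWithin ℝ eh Dom y d) Dom x u

/-- The weight `|F|^p + |ζ|^q + |w|^ρ + |η|^ℓ` appearing in the growth conditions. -/
def bigN (p q ρ ℓ : ℝ) (x : XE) : ℝ :=
  frob x.1.1 ^ p + frob x.1.2.1 ^ q + |x.1.2.2| ^ ρ + |x.2| ^ ℓ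

/-- Uniform convexity `∇²_{(ξ,η)} eh ≥ c 𝕀` (as quadratic forms, with the Euclidean
norm on `ℝ¹⁹ × ℝ`). -/
def UnifConvex (eh : XE → ℝ) (c : ℝ) : Prop :=
  ∀ x ∈ Dom, ∀ d : XE,
    c * (frob d.1.1 ^ 2 + frob d.1.2.1 ^ 2 + d.1.2.2 ^ 2 + d.2 ^ 2) ≤ d2 eh x d d

/-- Growth condition (G1): `c N(ξ,η) - c ≤ eh(ξ,η) ≤ c N(ξ,η) + c`. -/
def GrowthG1 (eh : XE → ℝ) (c p q ρ ℓ : ℝ) : Prop :=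
  ∀ x ∈ Dom, c * bigN p q ρ ℓ x - c ≤ eh x ∧ eh x ≤ c * bigN p q ρ ℓ x + c

/-- Growth condition (G2): `∂_η eh / N → 0` as `N → ∞`. -/
def GrowthG2 (eh : XE → ℝ) (p q ρ ℓ : ℝ) : Prop :=
  ∀ ε > (0:ℝ), ∃ R : ℝ, ∀ x ∈ Dom, R ≤ bigN p q ρ ℓ x → |dEta eh x| ≤ ε * bigN p q ρ ℓ x

/-- Growth condition (G3):
`|∂_F eh|^{p/(p-1)} + |∂_ζ eh|^{p/(p-2)} + |∂_w eh|^{p/(p-3)} ≤ c N + c`. -/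
def GrowthG3 (eh : XE → ℝ) (c p q ρ ℓ : ℝ) : Prop :=
  ∀ x ∈ Dom,
    frob (dFmat eh x) ^ (p / (p-1)) + frob (dZmat eh x) ^ (p / (p-2))
      + |dW eh x| ^ (p / (p-3)) ≤ c * bigN p q ρ ℓ x + c

/-- The relative internal energy
`eh(ξ,η | ξ̄,η̄) = eh(ξ,η) − eh(ξ̄,η̄) − ∇_ξ eh(ξ̄,η̄)·(ξ−ξ̄) − ∂_η eh(ξ̄,η̄)(η−η̄)`. -/
def erel (eh : XE → ℝ) (x xb : XE) : ℝ :=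
  eh x - eh xb - dXi eh xb (x.1 - xb.1) - dEta eh xb * (x.2 - xb.2)

/-- The relative total energy `I(v,ξ,η | v̄,ξ̄,η̄) = ½|v−v̄|² + eh(ξ,η|ξ̄,η̄)`. -/
def relI (eh : XE → ℝ) (v vb : Fin 3 → ℝ) (x xb : XE) : ℝ :=
  (1/2) * (∑ i, (v i - vb i)^2) + erel eh x xb

/-- The compact set `Γ_M = {(F̄,v̄,η̄) : |F̄| ≤ M, |v̄| ≤ M, 0 ≤ η̄ ≤ M}`. -/
def Gam (M : ℝ) (Fb : Mat) (vb : Fin 3 → ℝ) (ηb : ℝ) : Prop :=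
  frob Fb ≤ M ∧ Real.sqrt (∑ i, (vb i)^2) ≤ M ∧ 0 ≤ ηb ∧ ηb ≤ M

/-- `|Φ(F) − Φ(F̄)|²` (squared Euclidean distance of the null-Lagrangian vectors). -/
def phidist (F Fb : Mat) : ℝ :=
  frob (F - Fb) ^ 2 + frob (cof F - cof Fb) ^ 2 + (mdet F - mdet Fb) ^ 2

lemma frob_nonneg (F : Mat) : 0 ≤ frob F := Real.sqrt_nonneg _

lemma norm_le_frob (F : Mat) : ‖F‖ ≤ frob F := by
  refine (pi_norm_le_iff_of_nonneg (frob_nonneg F)).2 fun i =>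
    (pi_norm_le_iff_of_nonneg (frob_nonneg F)).2 fun j => ?_
  refine Real.abs_le_sqrt ?_
  calc F i j ^ 2 ≤ ∑ j, F i j ^ 2 :=
        Finset.single_le_sum (f := fun j => F i j ^ 2) (fun _ _ => sq_nonneg _) (Finset.mem_univ j)
    _ ≤ ∑ i, ∑ j, F i j ^ 2 :=
        Finset.single_le_sum (f := fun i => ∑ j, F i j ^ 2)
          (fun _ _ => Finset.sum_nonneg fun _ _ => sq_nonneg _) (Finset.mem_univ i)

/-- Bounding the four blocks of a point of `XE` bounds its norm. -/
lemma norm_XE_le {x : XE} {r : ℝ} (h1 : frob x.1.1 ≤ r) (h2 : frob x.1.2.1 ≤ r)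
    (h3 : |x.1.2.2| ≤ r) (h4 : |x.2| ≤ r) : ‖x‖ ≤ r := by
  simp only [Prod.norm_def, sup_le_iff, Real.norm_eq_abs]
  exact ⟨⟨(norm_le_frob _).trans h1, (norm_le_frob _).trans h2, h3⟩, h4⟩

lemma norm_sq_le_euclidean_sq (d : XE) :
    ‖d‖ ^ 2 ≤ frob d.1.1 ^ 2 + frob d.1.2.1 ^ 2 + d.1.2.2 ^ 2 + d.2 ^ 2 := by
  have h1 := sq_nonneg (frob d.1.1)
  have h2 := sq_nonneg (frob d.1.2.1)
  have h3 := sq_nonneg d.1.2.2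
  have h4 := sq_nonneg d.2
  rw [← Real.le_sqrt (norm_nonneg _) (by positivity)]
  refine norm_XE_le ?_ ?_ ?_ ?_
  · exact Real.le_sqrt_of_sq_le (by linarith)
  · exact Real.le_sqrt_of_sq_le (by linarith)
  · exact Real.abs_le_sqrt (by linarith)
  · exact Real.abs_le_sqrt (by linarith)

lemma bigN_nonneg (p q ρ ℓ : ℝ) (x : XE) : 0 ≤ bigN p q ρ ℓ x := by
  have h1 := frob_nonneg x.1.1
  have h2 := frob_nonneg x.1.2.1
  unfold bigN
  positivity

lemma norm_le_max_one_bigN {p q ρ ℓ : ℝ} (hp : 1 ≤ p) (hq : 1 ≤ q) (hρ : 1 ≤ ρ) (hℓ : 1 ≤ ℓ)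
    (x : XE) : ‖x‖ ≤ max 1 (bigN p q ρ ℓ x) := by
  have key : ∀ {t a : ℝ}, 1 ≤ a → t ^ a ≤ bigN p q ρ ℓ x → t ≤ max 1 (bigN p q ρ ℓ x) := by
    intro t a ha h
    rcases le_total t 1 with ht | ht
    · exact ht.trans (le_max_left _ _)
    · exact (Real.self_le_rpow_of_one_le ht ha).trans (h.trans (le_max_right _ _))
  have h1 := Real.rpow_nonneg (frob_nonneg x.1.1) p
  have h2 := Real.rpow_nonneg (frob_nonneg x.1.2.1) q
  have h3 := Real.rpow_nonneg (abs_nonneg x.1.2.2) ρ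
  have h4 := Real.rpow_nonneg (abs_nonneg x.2) ℓ
  refine norm_XE_le (key hp ?_) (key hq ?_) (key hρ ?_) (key hℓ ?_) <;> unfold bigN <;> linarith

lemma convex_Dom : Convex ℝ Dom :=
  (convex_Ici (0 : ℝ)).linear_preimage (LinearMap.snd ℝ Xi ℝ)

lemma isClosed_Dom : IsClosed Dom := isClosed_le continuous_const continuous_snd

lemma uniqueDiffOn_Dom : UniqueDiffOn ℝ Dom := by
  have h : Dom = (Set.univ : Set Xi) ×ˢ Set.Ici (0 : ℝ) := by
    ext x
    simp [Dom]
  rw [h]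
  exact uniqueDiffOn_univ.prod (uniqueDiffOn_Ici 0)

lemma isCompact_Dom_inter_closedBall (r : ℝ) :
    IsCompact (Dom ∩ Metric.closedBall (0 : XE) r) :=
  (isCompact_closedBall 0 r).inter_left isClosed_Dom

lemma continuous_Phi : Continuous Phi := by
  unfold Phi cof mdet
  fun_prop

lemma exists_norm_Phi_le (M : ℝ) :
    ∃ K : ℝ, ∀ (F : Mat) (η : ℝ), frob F ≤ M → 0 ≤ η → η ≤ M → ‖((Phi F, η) : XE)‖ ≤ K := by
  obtain ⟨K, hK⟩ := (isCompact_closedBall (0 : Mat) M).exists_bound_of_continuousOn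
    continuous_Phi.continuousOn
  refine ⟨max K M, fun F η hF h0 hη => ?_⟩
  rw [Prod.norm_def, Real.norm_of_nonneg h0]
  exact max_le_max (hK F (mem_closedBall_zero_iff.2 ((norm_le_frob F).trans hF))) hη

lemma erel_eq_fderivWithin (eh : XE → ℝ) (x xb : XE) :
    erel eh x xb = eh x - eh xb - fderivWithin ℝ eh Dom xb (x - xb) := by
  have h : x - xb = ((x.1 - xb.1, 0) : XE) + (x.2 - xb.2) • ((0, 1) : XE) := by
    ext <;> simp
  rw [h, map_add, map_smul, smul_eq_mul]
  unfold erel dXi dEta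
  ring

/-- A function on `[0, 1]` whose second derivative is at least `k` lies above its quadratic
Taylor lower bound. -/
lemma taylor_lower_bound {g g' g'' : ℝ → ℝ} {k : ℝ}
    (hg : ∀ t ∈ Set.Icc (0 : ℝ) 1, HasDerivWithinAt g (g' t) (Set.Icc 0 1) t)
    (hg' : ∀ t ∈ Set.Icc (0 : ℝ) 1, HasDerivWithinAt g' (g'' t) (Set.Icc 0 1) t)
    (hk : ∀ t ∈ Set.Icc (0 : ℝ) 1, k ≤ g'' t) :
    k / 2 ≤ g 1 - g 0 - g' 0 := by
  have h0 : (0 : ℝ) ∈ Set.Icc (0 : ℝ) 1 := by simp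
  have h1 : (1 : ℝ) ∈ Set.Icc (0 : ℝ) 1 := by simp
  have hd : ∀ t ∈ Set.Icc (0 : ℝ) 1,
      HasDerivWithinAt (fun s => g' s - k * s) (g'' t - k) (Set.Icc 0 1) t := fun t ht => by
    exact ((hg' t ht).sub ((hasDerivWithinAt_id t _).const_mul k)).congr_deriv (by simp)
  have hmono : MonotoneOn (fun s => g' s - k * s) (Set.Icc 0 1) :=
    monotoneOn_of_hasDerivWithinAt_nonneg (convex_Icc 0 1)
      (fun t ht => (hd t ht).continuousWithinAt)
      (fun t ht => (hd t (interior_subset ht)).mono interior_subset)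
      (fun t ht => sub_nonneg.2 (hk t (interior_subset ht)))
  have he : ∀ t ∈ Set.Icc (0 : ℝ) 1,
      HasDerivWithinAt (fun s => g s - g' 0 * s - k / 2 * s ^ 2) (g' t - g' 0 - k * t)
        (Set.Icc 0 1) t := fun t ht => by
    have := ((hg t ht).sub ((hasDerivWithinAt_id t _).const_mul (g' 0))).sub
      (((hasDerivWithinAt_id t (Set.Icc (0 : ℝ) 1)).pow 2).const_mul (k / 2))
    refine this.congr_deriv ?_
    simp
    ring
  have hmono' : MonotoneOn (fun s => g s - g' 0 * s - k / 2 * s ^ 2) (Set.Icc 0 1) :=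
    monotoneOn_of_hasDerivWithinAt_nonneg (convex_Icc 0 1)
      (fun t ht => (he t ht).continuousWithinAt)
      (fun t ht => (he t (interior_subset ht)).mono interior_subset)
      (fun t ht => by
        have ht' := interior_subset ht
        have := hmono h0 ht' ht'.1
        simp only at this
        linarith)
  have := hmono' h0 h1 zero_le_one
  simp only at this
  linarith

lemma contDiffOn_fderivWithin_Dom {eh : XE → ℝ} (h : ContDiffOn ℝ 3 eh Dom) :
    ContDiffOn ℝ 2 (fun x => fderivWithin ℝ eh Dom x) Dom :=
  h.fderivWithin uniqueDiffOn_Dom (by norm_num)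

/-- Uniform convexity bounds the relative energy below by the squared distance. -/
lemma UnifConvex.norm_sq_le_erel {eh : XE → ℝ} {c : ℝ} (hconv : UnifConvex eh c) (hc : 0 ≤ c)
    (hC3 : ContDiffOn ℝ 3 eh Dom) {x xb : XE} (hx : x ∈ Dom) (hxb : xb ∈ Dom) :
    c / 2 * ‖x - xb‖ ^ 2 ≤ erel eh x xb := by
  set d := x - xb with hd
  have hmaps : Set.MapsTo (fun t : ℝ => xb + t • d) (Set.Icc 0 1) Dom := fun t ht =>
    convex_Dom.add_smul_sub_mem hxb hx ht
  have hline : ∀ t : ℝ, HasDerivWithinAt (fun t : ℝ => xb + t • d) d (Set.Icc 0 1) t := fun t => by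
    simpa using ((hasDerivWithinAt_id t (Set.Icc (0 : ℝ) 1)).smul_const d).const_add xb
  have hD : DifferentiableOn ℝ (fun y => fderivWithin ℝ eh Dom y d) Dom :=
    ((contDiffOn_fderivWithin_Dom hC3).clm_apply contDiffOn_const).differentiableOn (by norm_num)
  have hderiv : ∀ t ∈ Set.Icc (0 : ℝ) 1, HasDerivWithinAt
      (fun t : ℝ => fderivWithin ℝ eh Dom (xb + t • d) d) (d2 eh (xb + t • d) d d)
      (Set.Icc 0 1) t := fun t ht => by
    have h := (hD _ (hmaps ht)).hasFDerivWithinAt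
    exact h.comp_hasDerivWithinAt t (hline t) hmaps
  have key := taylor_lower_bound (k := c * ‖d‖ ^ 2) (g := fun t => eh (xb + t • d))
    (g' := fun t => fderivWithin ℝ eh Dom (xb + t • d) d)
    (g'' := fun t => d2 eh (xb + t • d) d d)
    (fun t ht => (hC3.differentiableOn (by norm_num) _
      (hmaps ht)).hasFDerivWithinAt.comp_hasDerivWithinAt t (hline t) hmaps)
    hderiv
    (fun t ht => (mul_le_mul_of_nonneg_left (norm_sq_le_euclidean_sq d) hc).trans
      (hconv _ (hmaps ht) d))
  have hx1 : xb + (1 : ℝ) • d = x := by simp [hd]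
  simp only [hx1, zero_smul, add_zero] at key
  rw [erel_eq_fderivWithin]
  linarith

/-- The temperature is Lipschitz on bounded parts of the domain. -/
lemma exists_abs_dEta_sub_le {eh : XE → ℝ} (hC3 : ContDiffOn ℝ 3 eh Dom) (r : ℝ) :
    ∃ L : ℝ, ∀ x ∈ Dom ∩ Metric.closedBall (0 : XE) r, ∀ y ∈ Dom ∩ Metric.closedBall (0 : XE) r,
      |dEta eh x - dEta eh y| ≤ L * ‖x - y‖ := by
  have hD : ContDiffOn ℝ 2 (dEta eh) Dom :=
    (contDiffOn_fderivWithin_Dom hC3).clm_apply contDiffOn_const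
  obtain ⟨L, hL⟩ := (isCompact_Dom_inter_closedBall r).exists_bound_of_continuousOn
    ((hD.continuousOn_fderivWithin uniqueDiffOn_Dom (by norm_num)).mono Set.inter_subset_left)
  refine ⟨L, fun x hx y hy => ?_⟩
  exact (convex_Dom.inter (convex_closedBall 0 r)).norm_image_sub_le_of_norm_hasFDerivWithin_le
    (fun z hz => ((hD.differentiableOn (by norm_num) z hz.1).hasFDerivWithinAt).mono
      Set.inter_subset_left) hL hy hx

/-- The temperature grows at most linearly in the weight `bigN`. -/
lemma GrowthG2.exists_dEta_le {eh : XE → ℝ} {p q ρ ℓ : ℝ} (hG2 : GrowthG2 eh p q ρ ℓ)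
    (hC3 : ContDiffOn ℝ 3 eh Dom) (hp : 1 ≤ p) (hq : 1 ≤ q) (hρ : 1 ≤ ρ) (hℓ : 1 ≤ ℓ) :
    ∃ K : ℝ, 0 ≤ K ∧ ∀ x ∈ Dom, |dEta eh x| ≤ bigN p q ρ ℓ x + K := by
  obtain ⟨R, hR⟩ := hG2 1 one_pos
  have hD : ContinuousOn (dEta eh) Dom :=
    ((contDiffOn_fderivWithin_Dom hC3).clm_apply contDiffOn_const).continuousOn
  obtain ⟨K, hK⟩ := (isCompact_Dom_inter_closedBall (max 1 R)).exists_bound_of_continuousOn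
    (hD.mono Set.inter_subset_left)
  refine ⟨max K 0, le_max_right _ _, fun x hx => ?_⟩
  rcases le_total R (bigN p q ρ ℓ x) with h | h
  · linarith [hR x hx h, le_max_right K 0]
  · have hxR : ‖x‖ ≤ max 1 R :=
      (norm_le_max_one_bigN hp hq hρ hℓ x).trans (max_le_max le_rfl h)
    have := hK x ⟨hx, mem_closedBall_zero_iff.2 hxR⟩
    rw [Real.norm_eq_abs] at this
    linarith [bigN_nonneg p q ρ ℓ x, le_max_left K 0]

lemma abs_inv_sub_inv_mul_sub {a b : ℝ} (ha : 0 < a) (hb : 0 < b) :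
    |(1 / a - 1 / b) * (a - b)| = (a - b) ^ 2 / (a * b) := by
  have h : (1 / a - 1 / b) * (a - b) = -((a - b) ^ 2 / (a * b)) := by
    field_simp
    ring
  rw [h, abs_neg, abs_of_nonneg (by positivity)]

lemma abs_inv_sub_inv_mul_sub_le_sq {δ a b : ℝ} (hδ : 0 < δ) (ha : δ ≤ a) (hb : δ ≤ b) :
    |(1 / a - 1 / b) * (a - b)| ≤ (a - b) ^ 2 / δ ^ 2 := by
  rw [abs_inv_sub_inv_mul_sub (hδ.trans_le ha) (hδ.trans_le hb), sq δ]
  have ha0 := hδ.le.trans ha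
  gcongr

lemma abs_inv_sub_inv_mul_sub_le_add {δ a b : ℝ} (hδ : 0 < δ) (ha : δ ≤ a) (hb : δ ≤ b) :
    |(1 / a - 1 / b) * (a - b)| ≤ (a + b) / δ := by
  have ha0 := hδ.trans_le ha
  have hb0 := hδ.trans_le hb
  rw [abs_inv_sub_inv_mul_sub ha0 hb0, div_le_div_iff₀ (by positivity) hδ]
  have h1 : a * a * δ ≤ a * a * b := by gcongr
  have h2 : b * b * δ ≤ b * b * a := by gcongr
  nlinarith [mul_pos (mul_pos ha0 hb0) hδ]

/-- relative entropy estimate, part (III): temperature reciprocal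
bound.  Assume additionally `θ̂ = ∂_η eh ≥ δ > 0`.  Then for every `M > 0` there is
`C₅ > 0` such that
`|(1/θ̂(Φ(F),η) − 1/θ̂(Φ(F̄),η̄))(θ̂(Φ(F),η) − θ̂(Φ(F̄),η̄))|
  ≤ C₅ I(v,Φ(F),η | v̄,Φ(F̄),η̄)` for all `(F,v,η)` and `(F̄,v̄,η̄) ∈ Γ_M`. -/
theorem temperature_reciprocal_bound
    (c cg p q ρ ℓ : ℝ) (eh : XE → ℝ)
    (hc : 0 < c) (hcg : 0 < cg)
    (hp : 4 ≤ p) (hq : 2 ≤ q) (hρ : 1 < ρ) (hℓ : 1 < ℓ)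
    (hC3 : ContDiffOn ℝ 3 eh Dom)
    (hconv : UnifConvex eh c)
    (hG1 : GrowthG1 eh cg p q ρ ℓ)
    (hG2 : GrowthG2 eh p q ρ ℓ)
    (hG3 : GrowthG3 eh cg p q ρ ℓ)
    (δ : ℝ) (hδ : 0 < δ) (hθδ : ∀ x ∈ Dom, δ ≤ dEta eh x) :
    ∀ M > (0:ℝ), ∃ C₅ > (0:ℝ),
      ∀ (F Fb : Mat) (v vb : Fin 3 → ℝ) (η ηb : ℝ),
        0 ≤ η → Gam M Fb vb ηb →
        |(1 / dEta eh (Phi F, η) - 1 / dEta eh (Phi Fb, ηb))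
            * (dEta eh (Phi F, η) - dEta eh (Phi Fb, ηb))|
          ≤ C₅ * relI eh v vb (Phi F, η) (Phi Fb, ηb) := by
  intro M _
  obtain ⟨K, hK⟩ := exists_norm_Phi_le M
  obtain ⟨L, hL⟩ := exists_abs_dEta_sub_le hC3 (K + 1)
  obtain ⟨T, hT0, hT⟩ := hG2.exists_dEta_le hC3 (by linarith) (by linarith) hρ.le hℓ.le
  have hcpt := isCompact_Dom_inter_closedBall K
  obtain ⟨E, hE⟩ := hcpt.exists_bound_of_continuousOn
    (hC3.continuousOn.mono Set.inter_subset_left)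
  obtain ⟨G, hG⟩ := hcpt.exists_bound_of_continuousOn
    ((contDiffOn_fderivWithin_Dom hC3).continuousOn.mono Set.inter_subset_left)
  obtain ⟨B, hB⟩ := hcpt.exists_bound_of_continuousOn (f := dEta eh)
    (((contDiffOn_fderivWithin_Dom hC3).clm_apply contDiffOn_const).continuousOn.mono
      Set.inter_subset_left)
  set A : ℝ := ((1 + (cg + |E| + |G|) * (2 / c)) / cg + (T + |B|) * (2 / c)) / δ with hA
  have hA0 : 0 < A := by positivity
  refine ⟨L ^ 2 / δ ^ 2 * (2 / c) + A, by positivity, fun F Fb v vb η ηb hη hΓ => ?_⟩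
  obtain ⟨hFb, -, hηb, hηbM⟩ := hΓ
  set x : XE := (Phi F, η)
  set xb : XE := (Phi Fb, ηb)
  have hx : x ∈ Dom := hη
  have hxb : xb ∈ Dom := hηb
  have hxbK : ‖xb‖ ≤ K := hK Fb ηb hFb hηb hηbM
  have hmem : xb ∈ Dom ∩ Metric.closedBall 0 K := ⟨hxb, mem_closedBall_zero_iff.2 hxbK⟩
  have hconvx := hconv.norm_sq_le_erel hc.le hC3 hx hxb
  have hSI : erel eh x xb ≤ relI eh v vb x xb :=
    le_add_of_nonneg_left (mul_nonneg (by norm_num) (Finset.sum_nonneg fun _ _ => sq_nonneg _))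
  set S := erel eh x xb
  set r := ‖x - xb‖
  have hr0 : 0 ≤ r := norm_nonneg _
  have hS0 : 0 ≤ S := le_trans (by positivity) hconvx
  have hrS : r ^ 2 ≤ 2 / c * S := by
    rw [div_mul_eq_mul_div, le_div_iff₀ hc]
    linarith
  refine le_trans ?_ (mul_le_mul_of_nonneg_left hSI (by positivity))
  rcases le_total r 1 with h1 | h1
  · have hxK : ‖x‖ ≤ K + 1 := by linarith [norm_le_norm_add_norm_sub' x xb]
    have hLip := hL x ⟨hx, mem_closedBall_zero_iff.2 hxK⟩ xb
      ⟨hxb, mem_closedBall_zero_iff.2 (by linarith)⟩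
    calc _ ≤ (dEta eh x - dEta eh xb) ^ 2 / δ ^ 2 :=
          abs_inv_sub_inv_mul_sub_le_sq hδ (hθδ x hx) (hθδ xb hxb)
      _ ≤ (L * r) ^ 2 / δ ^ 2 := by
          gcongr ?_ / _
          exact sq_le_sq.2 (hLip.trans (le_abs_self _))
      _ = L ^ 2 / δ ^ 2 * r ^ 2 := by ring
      _ ≤ L ^ 2 / δ ^ 2 * (2 / c * S) := by gcongr
      _ ≤ (L ^ 2 / δ ^ 2 * (2 / c) + A) * S := by
          have := mul_nonneg hA0.le hS0
          linarith
  · have h1S : 1 ≤ 2 / c * S := by nlinarith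
    have hrS' : r ≤ 2 / c * S := by nlinarith
    have hEb : eh xb ≤ |E| := (le_abs_self _).trans ((hE xb hmem).trans (le_abs_self E))
    have hGb : fderivWithin ℝ eh Dom xb (x - xb) ≤ |G| * r :=
      (le_abs_self _).trans (((fderivWithin ℝ eh Dom xb).le_opNorm _).trans
        (mul_le_mul_of_nonneg_right ((hG xb hmem).trans (le_abs_self G)) hr0))
    have hBb : dEta eh xb ≤ |B| := (le_abs_self _).trans ((hB xb hmem).trans (le_abs_self B))
    have hN : bigN p q ρ ℓ x ≤ (1 + (cg + |E| + |G|) * (2 / c)) / cg * S := by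
      rw [div_mul_eq_mul_div, le_div_iff₀ hcg]
      have hSeq := erel_eq_fderivWithin eh x xb
      have hlow := (hG1 x hx).1
      have e1 : (cg + |E|) * 1 ≤ (cg + |E|) * (2 / c * S) := by gcongr
      have e2 : |G| * r ≤ |G| * (2 / c * S) := by gcongr
      linarith
    have hTB : T + |B| ≤ (T + |B|) * (2 / c * S) := le_mul_of_one_le_right (by positivity) h1S
    calc _ ≤ (dEta eh x + dEta eh xb) / δ :=
          abs_inv_sub_inv_mul_sub_le_add hδ (hθδ x hx) (hθδ xb hxb)
      _ ≤ (((1 + (cg + |E| + |G|) * (2 / c)) / cg + (T + |B|) * (2 / c)) * S) / δ := by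
          gcongr
          linarith [le_abs_self (dEta eh x), hT x hx]
      _ = A * S := by rw [hA]; ring
      _ ≤ (L ^ 2 / δ ^ 2 * (2 / c) + A) * S := by
          gcongr
          have : 0 ≤ L ^ 2 / δ ^ 2 * (2 / c) := by positivity
          linarith
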